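/- arXiv:1505.00486 — 2 statements merged into one kernel-verified Lean document; each statement's English description precedes it below -/
import Mathlib

section
/- Let G be a finite group, N a normal subgroup of G, and P a subgroup of G such that for every irreducible character ψ of P, the induced character Ind_P^G ψ has at least [G:N]+1 irreducible constituents counted with multiplicity. Then for every irreducible character η of P ∩ N, the induced character Ind_{P∩N}^N η is reducible. -/
open scoped Classical

/-- A function `χ : G → ℂ` is an irreducible character if it is the character of a simple
finite-dimensional complex representation of `G`. -/
def IsIrrChar {G : Type} [Group G] (χ : G → ℂ) : Prop :=
  ∃ V : FDRep ℂ G, CategoryTheory.Simple V ∧ V.character = χ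

/-- The character of `G` induced from a class function `ψ` on a subgroup `P ≤ G`. -/
noncomputable def indChar {G : Type} [Group G] [Fintype G] (P : Subgroup G) (ψ : P → ℂ) :
    G → ℂ := fun g =>
  (Nat.card P : ℂ)⁻¹ * ∑ x : G, if h : x⁻¹ * g * x ∈ P then ψ ⟨x⁻¹ * g * x, h⟩ else 0

open CategoryTheory Module

noncomputable def indHom {H G : Type} [Group H] [Group G] [Fintype H] [Fintype G] (φ : H →* G)
    (ψ : H → ℂ) : G → ℂ := fun g =>
  (Nat.card H : ℂ)⁻¹ * ∑ x : G, ∑ h : H, if x * φ h * x⁻¹ = g then ψ h else 0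

theorem indChar_eq {G : Type} [Group G] [Fintype G] (P : Subgroup G) [Fintype P] (ψ : P → ℂ) :
    indChar P ψ = indHom P.subtype ψ := by
  funext g
  unfold indChar indHom
  congr 1
  refine Finset.sum_congr rfl fun x _ => ?_
  split_ifs with h
  · rw [Finset.sum_eq_single (⟨x⁻¹ * g * x, h⟩ : P)]
    · rw [if_pos]
      simp [mul_assoc]
    · intro b _ hb
      rw [if_neg]
      rintro rfl
      apply hb
      ext
      simp [mul_assoc]
    · simp
  · symm
    apply Finset.sum_eq_zero
    intro b _
    rw [if_neg]
    rintro rfl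
    apply h
    simp [mul_assoc]

theorem indHom_sum {H G ι : Type} [Group H] [Group G] [Fintype H] [Fintype G] [Fintype ι]
    (φ : H →* G) (f : ι → H → ℂ) : indHom φ (∑ i, f i) = ∑ i, indHom φ (f i) := by
  funext g
  simp only [indHom, Finset.sum_apply, ← Finset.mul_sum]
  congr 1
  symm
  rw [Finset.sum_comm]
  refine Finset.sum_congr rfl fun x _ => ?_
  rw [Finset.sum_comm]
  refine Finset.sum_congr rfl fun y _ => ?_
  split_ifs
  · rfl
  · exact Finset.sum_const_zero

theorem indHom_comp {K H G : Type} [Group K] [Group H] [Group G] [Fintype K] [Fintype H]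
    [Fintype G] (ι : K →* H) (φ : H →* G) (ψ : K → ℂ) :
    indHom φ (indHom ι ψ) = indHom (φ.comp ι) ψ := by
  funext g
  have key : ∀ x : G, ∀ h : H, (if x * φ h * x⁻¹ = g then indHom ι ψ h else 0) =
      (Nat.card K : ℂ)⁻¹ * ∑ y : H, ∑ k : K,
        if y * ι k * y⁻¹ = h then (if x * φ h * x⁻¹ = g then ψ k else 0) else 0 := by
    intro x h
    split_ifs with hx
    · rfl
    · simp
  have k2 : ∀ x : G, ∑ h : H, (if x * φ h * x⁻¹ = g then indHom ι ψ h else 0) =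
      (Nat.card K : ℂ)⁻¹ * ∑ y : H, ∑ k : K,
        if (x * φ y) * φ (ι k) * (x * φ y)⁻¹ = g then ψ k else 0 := by
    intro x
    simp only [key, ← Finset.mul_sum]
    congr 1
    rw [Finset.sum_comm]
    refine Finset.sum_congr rfl fun y _ => ?_
    rw [Finset.sum_comm]
    refine Finset.sum_congr rfl fun k _ => ?_
    rw [Finset.sum_ite_eq]
    simp [mul_assoc]
  unfold indHom at k2 ⊢
  simp only [k2, ← Finset.mul_sum]
  rw [Finset.sum_comm]
  have k3 : ∀ y : H, ∑ x : G, ∑ k : K,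
        (if (x * φ y) * φ (ι k) * (x * φ y)⁻¹ = g then ψ k else 0) =
      ∑ x : G, ∑ k : K, if x * φ (ι k) * x⁻¹ = g then ψ k else 0 := by
    intro y
    exact Fintype.sum_equiv (Equiv.mulRight (φ y)) _ _ (fun x => rfl)
  simp only [k3, MonoidHom.comp_apply]
  have : (Nat.card H : ℂ) ≠ 0 := by exact_mod_cast Nat.card_pos.ne'
  simp
  field_simp

theorem indHom_one {H G : Type} [Group H] [Group G] [Fintype H] [Fintype G] (φ : H →* G)
    (hφ : Function.Injective φ) (ψ : H → ℂ) (h : ψ 1 ≠ 0) : indHom φ ψ ≠ 0 := by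
  intro h0
  have := congrFun h0 1
  simp [indHom] at this
  have e : ∀ b, φ b = 1 ↔ b = 1 := fun b => by rw [← map_one φ]; exact hφ.eq_iff
  simp [e, h] at this

/-- trace of a permutation-like map -/
theorem trace_funLeft {X : Type} [Fintype X] (σ : X → X) :
    LinearMap.trace ℂ (X → ℂ) (LinearMap.funLeft ℂ ℂ σ) = ∑ x, if σ x = x then 1 else 0 := by
  rw [LinearMap.trace_eq_matrix_trace ℂ (Pi.basisFun ℂ X)]
  simp only [Matrix.trace, Matrix.diag, LinearMap.toMatrix_apply]
  refine Finset.sum_congr rfl fun x _ => ?_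
  simp [LinearMap.funLeft_apply, Pi.single_apply]

open TensorProduct in
theorem exists_rep_indHom {H G : Type} [Group H] [Group G] [Fintype H] [Fintype G] (φ : H →* G)
    (V : Type) [AddCommGroup V] [Module ℂ V] [FiniteDimensional ℂ V] (ρ : Representation ℂ H V) :
    ∃ (W : Type) (_ : AddCommGroup W) (_ : Module ℂ W) (_ : FiniteDimensional ℂ W)
      (σ : Representation ℂ G W), σ.character = indHom φ ρ.character := by
  let A : Representation ℂ G ((G → ℂ) ⊗[ℂ] V) :=
    { toFun := fun g => TensorProduct.map (LinearMap.funLeft ℂ ℂ (fun x => g⁻¹ * x)) LinearMap.id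
      map_one' := by
        ext; simp [LinearMap.funLeft]; rfl
      map_mul' := by
        intro a b
        rw [Module.End.mul_eq_comp, ← TensorProduct.map_comp, ← LinearMap.funLeft_comp]
        congr 2
        funext x; simp [mul_assoc] }
  let B : Representation ℂ H ((G → ℂ) ⊗[ℂ] V) :=
    { toFun := fun h => TensorProduct.map (LinearMap.funLeft ℂ ℂ (fun x => x * φ h)) (ρ h)
      map_one' := by
        ext; simp [LinearMap.funLeft]; rfl
      map_mul' := by
        intro a b
        rw [Module.End.mul_eq_comp, ← TensorProduct.map_comp, ← LinearMap.funLeft_comp, map_mul,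
          map_mul, Module.End.mul_eq_comp]
        congr 2
        funext x; simp [mul_assoc] }
  have hAB : ∀ g h, A g ∘ₗ B h =
      TensorProduct.map (LinearMap.funLeft ℂ ℂ (fun x => g⁻¹ * x * φ h)) (ρ h) := by
    intro g h
    change TensorProduct.map _ _ ∘ₗ TensorProduct.map _ _ = _
    rw [← TensorProduct.map_comp, ← LinearMap.funLeft_comp]
    rfl
  have hBA : ∀ g h, B h ∘ₗ A g =
      TensorProduct.map (LinearMap.funLeft ℂ ℂ (fun x => g⁻¹ * x * φ h)) (ρ h) := by
    intro g h
    change TensorProduct.map _ _ ∘ₗ TensorProduct.map _ _ = _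
    rw [← TensorProduct.map_comp, ← LinearMap.funLeft_comp]
    congr 2
    funext x; simp [mul_assoc]
  have hinv : ∀ g, ∀ w ∈ B.invariants, A g w ∈ B.invariants := by
    intro g w hw h
    have h1 : B h (A g w) = A g (B h w) := by
      rw [← LinearMap.comp_apply, hBA, ← hAB]; rfl
    rw [h1, hw h]
  let σ : Representation ℂ G B.invariants :=
    { toFun := fun g => (A g).restrict (hinv g)
      map_one' := by ext; simp
      map_mul' := by intro a b; ext; simp }
  refine ⟨B.invariants, inferInstance, inferInstance, inferInstance, σ, ?_⟩
  funext g
  have : Invertible (Fintype.card H : ℂ) :=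
    invertibleOfNonzero (by exact_mod_cast Fintype.card_ne_zero)
  have hm : ∀ w, (A g ∘ₗ B.averageMap) w ∈ B.invariants := fun w =>
    hinv g _ (B.averageMap_invariant w)
  have h1 : σ g = (A g ∘ₗ B.averageMap).restrict (fun w _ => hm w) := by
    ext w
    change A g w.1 = A g (B.averageMap w.1)
    rw [B.averageMap_id w.1 w.2]
  unfold Representation.character
  rw [h1, LinearMap.trace_restrict_eq_of_forall_mem _ _ hm]
  have h2 : A g ∘ₗ B.averageMap = (Nat.card H : ℂ)⁻¹ • ∑ h : H, A g ∘ₗ B h := by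
    ext
    simp [Representation.averageMap, GroupAlgebra.average, map_sum]
  rw [h2]
  simp only [map_smul, map_sum, hAB, LinearMap.trace_tensorProduct', trace_funLeft, smul_eq_mul,
    indHom, Finset.sum_mul]
  congr 1
  rw [Finset.sum_comm]
  refine Finset.sum_congr rfl fun x _ => ?_
  refine Finset.sum_congr rfl fun h _ => ?_
  have : g⁻¹ * x * φ h = x ↔ x * φ h * x⁻¹ = g := by
    rw [mul_assoc, inv_mul_eq_iff_eq_mul, mul_inv_eq_iff_eq_mul]
  simp [this]

theorem isIrrChar_of_norm {G : Type} [Group G] [Fintype G] (V : Type) [AddCommGroup V] [Module ℂ V]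
    [FiniteDimensional ℂ V] (ρ : Representation ℂ G V)
    (h : ∑ g : G, ρ.character g * ρ.character g⁻¹ = Nat.card G) : IsIrrChar ρ.character :=
  ⟨FDRep.of ρ, (FDRep.simple_iff_char_is_norm_one (FDRep.of ρ)).2 h, rfl⟩

theorem decomp {G : Type} [Group G] [Fintype G] (n : ℕ) : ∀ (V : Type) [AddCommGroup V] [Module ℂ V]
    [FiniteDimensional ℂ V] (ρ : Representation ℂ G V), finrank ℂ V = n →
    ∃ (t : ℕ) (f : Fin t → G → ℂ), (∀ i, IsIrrChar (f i)) ∧ ρ.character = ∑ i, f i := by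
  induction n using Nat.strong_induction_on with
  | _ n ih =>
  intro V _ _ _ ρ hn
  have hinv : Invertible (Nat.card G : ℂ) :=
    invertibleOfNonzero (by exact_mod_cast Nat.card_pos.ne')
  by_cases hs : Subsingleton V
  · refine ⟨0, Fin.elim0, fun i => i.elim0, ?_⟩
    funext g
    have : ρ g = 0 := Subsingleton.elim _ _
    simp [Representation.character, this]
  by_cases hirr : ρ.IsIrreducible
  · refine ⟨1, fun _ => ρ.character, fun _ => isIrrChar_of_norm V ρ ?_, by simp⟩
    have := Representation.char_orthonormal ρ ρ
    rw [if_pos ⟨.refl ρ⟩, inv_mul_eq_iff_eq_mul₀ (by exact_mod_cast Nat.card_pos.ne')] at this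
    simpa using this
  have : ∃ U : Subrepresentation ρ, U ≠ ⊥ ∧ U ≠ ⊤ := by
    by_contra hc
    push Not at hc
    apply hirr
    rw [not_subsingleton_iff_nontrivial] at hs
    have : Nontrivial (Subrepresentation ρ) := by
      refine ⟨⊥, ⊤, fun h => ?_⟩
      have := congrArg Subrepresentation.toSubmodule h
      exact bot_ne_top (α := Submodule ℂ V) this
    exact { eq_bot_or_eq_top := fun U => by
              by_cases hU : U = ⊥
              · exact .inl hU
              · exact .inr (hc U hU) }
  obtain ⟨U, hb, ht⟩ := this
  have : NeZero (Nat.card G : ℂ) := ⟨by exact_mod_cast Nat.card_pos.ne'⟩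
  obtain ⟨U', hc⟩ := exists_isCompl U
  have hc' : IsCompl U.toSubmodule U'.toSubmodule := by
    refine IsCompl.of_eq ?_ ?_
    · exact congrArg Subrepresentation.toSubmodule hc.inf_eq_bot
    · exact congrArg Subrepresentation.toSubmodule hc.sup_eq_top
  have hne : U.toSubmodule ≠ ⊥ := fun h => hb (Subrepresentation.toSubmodule_injective h)
  have hnt : U.toSubmodule ≠ ⊤ := fun h => ht (Subrepresentation.toSubmodule_injective h)
  have hd := Submodule.finrank_add_eq_of_isCompl hc'
  have hlt := Submodule.finrank_lt hnt
  have hpos : 0 < finrank ℂ U.toSubmodule := by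
    rw [Nat.pos_iff_ne_zero]; exact fun h => hne (Submodule.finrank_eq_zero.1 h)
  obtain ⟨t, f, hf, hf'⟩ := ih _ (by omega) U.toSubmodule U.toRepresentation rfl
  obtain ⟨t', f', hf2, hf2'⟩ := ih _ (by omega) U'.toSubmodule U'.toRepresentation rfl
  refine ⟨t + t', Fin.append f f', ?_, ?_⟩
  · intro i
    refine Fin.addCases (fun i => ?_) (fun i => ?_) i
    · simpa using hf i
    · simpa using hf2 i
  · rw [Fin.sum_univ_add]
    simp only [Fin.append_left, Fin.append_right]
    rw [← hf', ← hf2']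
    funext g
    let e := Submodule.prodEquivOfIsCompl _ _ hc'
    have : ρ g = e.conj (LinearMap.prodMap (U.toRepresentation g) (U'.toRepresentation g)) := by
      ext v
      obtain ⟨w, rfl⟩ := e.surjective v
      simp [e, LinearEquiv.conj_apply, Subrepresentation.toRepresentation]
    simp only [Representation.character, Pi.add_apply]
    rw [this, LinearMap.trace_conj', LinearMap.trace_prodMap']

noncomputable def ip {G : Type} [Group G] [Fintype G] (a b : G → ℂ) : ℂ :=
  (Nat.card G : ℂ)⁻¹ * ∑ g : G, a g * b g⁻¹

theorem ip_sum {G ι κ : Type} [Group G] [Fintype G] [Fintype ι] [Fintype κ] (a : ι → G → ℂ)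
    (b : κ → G → ℂ) : ip (∑ i, a i) (∑ j, b j) = ∑ i, ∑ j, ip (a i) (b j) := by
  simp only [ip, Finset.sum_apply, ← Finset.mul_sum, Finset.sum_mul_sum]
  congr 1
  rw [Finset.sum_comm]
  refine Finset.sum_congr rfl fun i _ => ?_
  rw [Finset.sum_comm]
  simp only [Finset.mul_sum]

theorem ip_irr {G : Type} [Group G] [Fintype G] (a b : G → ℂ) (ha : IsIrrChar a)
    (hb : IsIrrChar b) : ip a b = 0 ∨ ip a b = 1 := by
  obtain ⟨V, hV, rfl⟩ := ha
  obtain ⟨W, hW, rfl⟩ := hb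
  have hinv : Invertible (Nat.card G : ℂ) :=
    invertibleOfNonzero (by exact_mod_cast Nat.card_pos.ne')
  have := FDRep.char_orthonormal V W
  unfold ip
  rw [this]
  split_ifs <;> simp

theorem ip_self {G : Type} [Group G] [Fintype G] (a : G → ℂ) (ha : IsIrrChar a) : ip a a = 1 := by
  obtain ⟨V, hV, rfl⟩ := ha
  have := (FDRep.simple_iff_char_is_norm_one V).1 hV
  unfold ip
  rw [this, inv_mul_cancel₀ (by exact_mod_cast Nat.card_pos.ne')]

theorem card_le_ip {G ι : Type} [Group G] [Fintype G] [Fintype ι] (f : ι → G → ℂ)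
    (hf : ∀ i, IsIrrChar (f i)) : (Fintype.card ι : ℝ) ≤ (ip (∑ i, f i) (∑ i, f i)).re := by
  rw [ip_sum, Complex.re_sum]
  have : (Fintype.card ι : ℝ) = ∑ i : ι, 1 := by simp
  rw [this]
  refine Finset.sum_le_sum fun i _ => ?_
  rw [Complex.re_sum]
  have : (1 : ℝ) = (ip (f i) (f i)).re := by rw [ip_self _ (hf i)]; simp
  rw [this]
  refine Finset.single_le_sum (f := fun j => (ip (f i) (f j)).re) (fun j _ => ?_)
    (Finset.mem_univ i)
  rcases ip_irr _ _ (hf i) (hf j) with h | h <;> simp [h]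

theorem isIrrChar_comp {G : Type} [Group G] [Fintype G] (a : G → ℂ) (ha : IsIrrChar a)
    (e : G ≃* G) : IsIrrChar (fun g => a (e g)) := by
  obtain ⟨V, hV, rfl⟩ := ha
  have := (FDRep.simple_iff_char_is_norm_one V).1 hV
  let ρ : Representation ℂ G V := V.ρ.comp e.toMonoidHom
  change IsIrrChar ρ.character
  refine isIrrChar_of_norm V ρ ?_
  rw [← this]
  refine Fintype.sum_equiv e.toEquiv _ _ fun g => ?_
  change V.character (e g) * V.character (e g⁻¹) = V.character (e g) * V.character (e g)⁻¹
  rw [map_inv]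

/-- The inner product of an induced character from a normal subgroup. -/
theorem ip_ind_normal {G : Type} [Group G] [Fintype G] (N : Subgroup G) [N.Normal] [Fintype N]
    (θ : N → ℂ) (hθ : IsIrrChar θ) :
    (ip (indChar N θ) (indChar N θ)).re ≤ N.index := by
  let T : G → N → ℂ := fun x n => θ (MulAut.conjNormal x⁻¹ n)
  have hT : ∀ x, IsIrrChar (T x) := fun x => isIrrChar_comp θ hθ (MulAut.conjNormal x⁻¹)
  have hN : ∀ n : N, indChar N θ n = (Nat.card N : ℂ)⁻¹ * (∑ x, T x) n := by
    intro n
    unfold indChar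
    rw [Finset.sum_apply]
    congr 1
    refine Finset.sum_congr rfl fun x _ => ?_
    have hx : x⁻¹ * n * x ∈ N := by
      have := Subgroup.Normal.conj_mem ‹_› (n : G) n.2 x⁻¹
      simpa using this
    rw [dif_pos hx]
    simp only [T]
    congr 1
    ext
    simp [MulAut.conjNormal_apply]
  have h0 : ∀ g : G, g ∉ N → indChar N θ g = 0 := by
    intro g hg
    unfold indChar
    rw [Finset.sum_eq_zero, mul_zero]
    intro x _
    rw [dif_neg]
    intro hx
    apply hg
    have := Subgroup.Normal.conj_mem ‹_› _ hx x
    simpa [mul_assoc] using this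
  have hs : ∑ g : G, indChar N θ g * indChar N θ g⁻¹ =
      ∑ n : N, indChar N θ n * indChar N θ (n : G)⁻¹ := by
    symm
    refine Fintype.sum_of_injective (fun n : N => (n : G)) Subtype.val_injective _ _ ?_ ?_
    · intro g hg
      rw [h0 g (by simpa using hg), zero_mul]
    · intro n; rfl
  have hcN : (Nat.card N : ℂ) ≠ 0 := by exact_mod_cast Nat.card_pos.ne'
  have hcG : (Nat.card G : ℂ) ≠ 0 := by exact_mod_cast Nat.card_pos.ne'
  have h1 : ip (indChar N θ) (indChar N θ) =
      (((Nat.card G : ℝ) * Nat.card N)⁻¹ : ℝ) * ip (∑ x, T x) (∑ x, T x) := by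
    have hn' : ∀ n : N, indChar N θ (n : G)⁻¹ = (Nat.card N : ℂ)⁻¹ * (∑ x, T x) n⁻¹ :=
      fun n => hN n⁻¹
    unfold ip
    rw [hs]
    simp only [hN, hn']
    have : ∀ n : N, (Nat.card N : ℂ)⁻¹ * (∑ x, T x) n * ((Nat.card N : ℂ)⁻¹ * (∑ x, T x) n⁻¹) =
      (Nat.card N : ℂ)⁻¹ * (Nat.card N : ℂ)⁻¹ * ((∑ x, T x) n * (∑ x, T x) n⁻¹) := by
      intro n; ring
    simp only [this, ← Finset.mul_sum]
    push_cast
    rw [mul_inv]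
    ring
  have h2 : (ip (∑ x, T x) (∑ x, T x)).re ≤ (Nat.card G : ℝ) * Nat.card G := by
    rw [ip_sum]
    simp only [Complex.re_sum]
    calc _ ≤ ∑ x : G, ∑ y : G, (1 : ℝ) := by
          refine Finset.sum_le_sum fun x _ => Finset.sum_le_sum fun y _ => ?_
          rcases ip_irr _ _ (hT x) (hT y) with h | h <;> simp [h]
      _ = _ := by simp
  rw [h1, Complex.re_ofReal_mul]
  have hGp : (0 : ℝ) < Nat.card G := by exact_mod_cast Nat.card_pos
  have hNp : (0 : ℝ) < Nat.card N := by exact_mod_cast Nat.card_pos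
  have hidx : (Nat.card G : ℝ) = Nat.card N * N.index := by
    exact_mod_cast (N.card_mul_index).symm
  rw [inv_mul_le_iff₀ (by positivity)]
  refine h2.trans (le_of_eq ?_)
  rw [mul_assoc, ← hidx]

/-- If `N ⊴ G` and `P ≤ G` is such that every decomposition of `Ind_P^G ψ`, for `ψ` an
irreducible character of `P`, into a sum of irreducible characters has more than `[G:N]`
summands (i.e. the branching index satisfies `b_P(G) > [G:N]`), then for every irreducible
character `η` of `P ∩ N`, the induced character `Ind_{P∩N}^N η` is reducible. -/
theorem induced_reducible_in_normal_of_large_branching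
    {G : Type} [Group G] [Fintype G] (N P : Subgroup G) [N.Normal] [Fintype N]
    (hbranch : ∀ ψ : P → ℂ, IsIrrChar ψ →
      ∀ (t : ℕ) (f : Fin t → (G → ℂ)), (∀ i, IsIrrChar (f i)) →
        indChar P ψ = ∑ i, f i → N.index + 1 ≤ t)
    (η : (P.subgroupOf N) → ℂ) (hη : IsIrrChar η) :
    ¬ IsIrrChar (indChar (P.subgroupOf N) η) := by
  intro hθ
  have hB : ∀ (H G : Type) [Group H] [Group G] [Fintype H] [Fintype G] (φ : H →* G) (ψ : H → ℂ),
      IsIrrChar ψ → ∃ (t : ℕ) (f : Fin t → G → ℂ),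
        (∀ i, IsIrrChar (f i)) ∧ indHom φ ψ = ∑ i, f i := by
    rintro H G _ _ _ _ φ ψ ⟨V, _, rfl⟩
    obtain ⟨W, _, _, _, σ, hσ⟩ := exists_rep_indHom φ V V.ρ
    obtain ⟨t, f, hf, hf'⟩ := decomp _ W σ rfl
    exact ⟨t, f, hf, by rw [← hf', hσ]; rfl⟩
  let ι : P.subgroupOf N →* P :=
    { toFun := fun k => ⟨k.1.1, k.2⟩
      map_one' := rfl
      map_mul' := fun _ _ => rfl }
  have hι : Function.Injective ι := by
    intro a b hab
    have : (ι a : G) = ι b := by rw [hab]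
    exact Subtype.ext (Subtype.ext this)
  obtain ⟨s, ψ, hψ, hψs⟩ := hB _ _ ι η hη
  have hex := fun j => hB _ _ P.subtype (ψ j) (hψ j)
  choose t f hf hfs using hex
  have ht : ∀ j, N.index + 1 ≤ t j := fun j =>
    hbranch (ψ j) (hψ j) (t j) (f j) (hf j) (by rw [indChar_eq, hfs])
  have hsum : indChar N (indChar (P.subgroupOf N) η) =
      ∑ p : (Σ j : Fin s, Fin (t j)), f p.1 p.2 := by
    rw [indChar_eq, indChar_eq, indHom_comp, Fintype.sum_sigma]
    simp only [← hfs]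
    rw [← indHom_sum, ← hψs, indHom_comp]
    rfl
  have h1 := card_le_ip (fun p : (Σ j : Fin s, Fin (t j)) => f p.1 p.2) (fun p => hf p.1 p.2)
  have h2 := ip_ind_normal N _ hθ
  rw [hsum] at h2
  have h3 : Fintype.card (Σ j : Fin s, Fin (t j)) ≤ N.index := by exact_mod_cast h1.trans h2
  rw [Fintype.card_sigma] at h3
  simp only [Fintype.card_fin] at h3
  have hs : s ≠ 0 := by
    rintro rfl
    refine indHom_one ι hι η ?_ (by simpa using hψs)
    obtain ⟨V, hV, rfl⟩ := hη
    have hn := (FDRep.simple_iff_char_is_norm_one V).1 hV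
    rw [FDRep.char_one]
    intro h0
    have h0' : finrank ℂ V = 0 := by exact_mod_cast h0
    have : Subsingleton V := finrank_zero_iff.1 h0'
    have hz : ∀ g, V.character g = 0 := by
      intro g
      have : V.ρ g = 0 := Subsingleton.elim _ _
      unfold FDRep.character
      rw [this, map_zero]
    simp only [hz, mul_zero, Finset.sum_const_zero] at hn
    have hc : Nat.card (P.subgroupOf N) = 0 := by exact_mod_cast hn.symm
    exact Nat.card_pos.ne' hc
  obtain ⟨j⟩ : Nonempty (Fin s) := ⟨⟨0, Nat.pos_of_ne_zero hs⟩⟩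
  have := Finset.single_le_sum (f := t) (fun _ _ => Nat.zero_le _) (Finset.mem_univ j)
  have := ht j
  omega
end

section
/- Let W = B_n be the hyperoctahedral group acting on ℂⁿ, and let π_λ be the irreducible representation of S_n labeled by a partition λ of n, viewed as a B_n-representation via the quotient B_n → S_n. Suppose that for every 1 ≤ i ≤ n the element Σ_{j≠i} ((i,j) + (i,j)·ε_i(-1)ε_j(-1)) of the group algebra acts on π_λ by the scalar -2m, for a fixed integer m ≥ 0. Then λ is a rectangle (k^{k+m}) for some positive integer k with n = k(k+m). -/
open scoped Classical

noncomputable section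

/-- Sum, in the group algebra, over the row-stabiliser of the canonical tableau of `μ`. -/
def rowSym (μ : YoungDiagram) : MonoidAlgebra ℂ (Equiv.Perm μ.cells) :=
  ∑ σ ∈ Finset.univ.filter
      (fun σ : Equiv.Perm μ.cells => ∀ c : μ.cells, ((σ c : ℕ × ℕ).1 = (c : ℕ × ℕ).1)),
    MonoidAlgebra.single σ (1 : ℂ)

/-- Signed sum, in the group algebra, over the column-stabiliser of the canonical tableau
of `μ`. -/
def colSym (μ : YoungDiagram) : MonoidAlgebra ℂ (Equiv.Perm μ.cells) :=
  ∑ σ ∈ Finset.univ.filter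
      (fun σ : Equiv.Perm μ.cells => ∀ c : μ.cells, ((σ c : ℕ × ℕ).2 = (c : ℕ × ℕ).2)),
    MonoidAlgebra.single σ ((Equiv.Perm.sign σ : ℤ) : ℂ)

/-- The Young symmetrizer of the canonical tableau of shape `μ`. -/
def youngSymmetrizer (μ : YoungDiagram) : MonoidAlgebra ℂ (Equiv.Perm μ.cells) :=
  rowSym μ * colSym μ

/-- The Specht module `π_μ`: the left ideal of the group algebra generated by the Young
symmetrizer of shape `μ`. -/
def spechtIdeal (μ : YoungDiagram) : Submodule ℂ (MonoidAlgebra ℂ (Equiv.Perm μ.cells)) :=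
  LinearMap.range (LinearMap.mulRight ℂ (youngSymmetrizer μ))


lemma ys_coeff (μ : YoungDiagram) (t : Equiv.Perm μ.cells) :
    (youngSymmetrizer μ).coeff t =
      ∑ σ ∈ Finset.univ.filter
        (fun σ : Equiv.Perm μ.cells => ∀ c : μ.cells, ((σ c : ℕ × ℕ).1 = (c : ℕ × ℕ).1)),
      ∑ τ ∈ Finset.univ.filter
        (fun σ : Equiv.Perm μ.cells => ∀ c : μ.cells, ((σ c : ℕ × ℕ).2 = (c : ℕ × ℕ).2)),
        if σ * τ = t then ((Equiv.Perm.sign τ : ℤ) : ℂ) else 0 := by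
  simp only [youngSymmetrizer, rowSym, colSym, Finset.sum_mul, Finset.mul_sum,
    MonoidAlgebra.single_mul_single, MonoidAlgebra.coeff_sum, Finsupp.finsetSum_apply,
    MonoidAlgebra.coeff_single, Finsupp.single_apply, one_mul]
  exact Finset.sum_comm

lemma fac_row {μ : YoungDiagram} {σ τ t : Equiv.Perm μ.cells}
    (hσ : ∀ c : μ.cells, ((σ c : ℕ × ℕ).1 = (c : ℕ × ℕ).1)) (h : σ * τ = t) (x : μ.cells) :
    (τ x : ℕ × ℕ).1 = (t x : ℕ × ℕ).1 := by
  rw [← h, Equiv.Perm.mul_apply, hσ]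

lemma ys_coeff_row (μ : YoungDiagram) (t : Equiv.Perm μ.cells)
    (ht : ∀ c : μ.cells, ((t c : ℕ × ℕ).1 = (c : ℕ × ℕ).1)) :
    (youngSymmetrizer μ).coeff t = 1 := by
  have key : ∀ σ τ : Equiv.Perm μ.cells, (∀ c : μ.cells, ((σ c : ℕ × ℕ).1 = (c : ℕ × ℕ).1)) →
      (∀ c : μ.cells, ((τ c : ℕ × ℕ).2 = (c : ℕ × ℕ).2)) → σ * τ = t → τ = 1 := by
    intro σ τ hσ hτ h
    ext x : 1
    apply Subtype.ext
    apply Prod.ext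
    · rw [fac_row hσ h, ht]; rfl
    · rw [hτ]; rfl
  rw [ys_coeff, Finset.sum_eq_single t, Finset.sum_eq_single 1]
  · simp
  · intro τ hτ h1
    rw [if_neg]
    intro h
    exact h1 (key t τ ht (by simpa using hτ) h)
  · intro h
    exact absurd (by simp) h
  · intro σ hσ hst
    apply Finset.sum_eq_zero
    intro τ hτ
    rw [if_neg]
    intro h
    have := key σ τ (by simpa using hσ) (by simpa using hτ) h
    subst this
    exact hst (by simpa using h)
  · intro h
    exact absurd (by simpa using ht) h

lemma ys_coeff_col (μ : YoungDiagram) (t : Equiv.Perm μ.cells)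
    (ht : ∀ c : μ.cells, ((t c : ℕ × ℕ).2 = (c : ℕ × ℕ).2)) :
    (youngSymmetrizer μ).coeff t = ((Equiv.Perm.sign t : ℤ) : ℂ) := by
  have key : ∀ σ τ : Equiv.Perm μ.cells, (∀ c : μ.cells, ((σ c : ℕ × ℕ).1 = (c : ℕ × ℕ).1)) →
      (∀ c : μ.cells, ((τ c : ℕ × ℕ).2 = (c : ℕ × ℕ).2)) → σ * τ = t → τ = t := by
    intro σ τ hσ hτ h
    ext x : 1
    apply Subtype.ext
    apply Prod.ext
    · rw [fac_row hσ h]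
    · rw [hτ, ht]
  rw [ys_coeff, Finset.sum_eq_single 1, Finset.sum_eq_single t]
  · simp
  · intro τ hτ h1
    rw [if_neg]
    intro h
    exact h1 (by simpa using h)
  · intro h
    exact absurd (by simpa using ht) h
  · intro σ hσ hst
    apply Finset.sum_eq_zero
    intro τ hτ
    rw [if_neg]
    intro h
    have := key σ τ (by simpa using hσ) (by simpa using hτ) h
    subst this
    exact hst (by simpa using h)
  · intro h
    exact absurd (by simp) h

lemma ys_coeff_swap_zero (μ : YoungDiagram) (c d : μ.cells)
    (h1 : (c : ℕ × ℕ).1 ≠ (d : ℕ × ℕ).1) (h2 : (c : ℕ × ℕ).2 ≠ (d : ℕ × ℕ).2) :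
    (youngSymmetrizer μ).coeff (Equiv.swap c d) = 0 := by
  rw [ys_coeff]
  apply Finset.sum_eq_zero
  intro σ hσ
  apply Finset.sum_eq_zero
  intro τ hτ
  rw [if_neg]
  intro h
  have hσ' : ∀ c : μ.cells, ((σ c : ℕ × ℕ).1 = (c : ℕ × ℕ).1) := by simpa using hσ
  have hτ' : ∀ c : μ.cells, ((τ c : ℕ × ℕ).2 = (c : ℕ × ℕ).2) := by simpa using hτ
  have ec1 := fac_row hσ' h c
  rw [Equiv.swap_apply_left] at ec1
  have ec2 := hτ' c
  have n1 : τ c ≠ c := fun e => h1 (by rw [← ec1, e])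
  have n2 : τ c ≠ d := fun e => h2 (by rw [← ec2, e])
  have f1 := fac_row hσ' h (τ c)
  rw [Equiv.swap_apply_of_ne_of_ne n1 n2] at f1
  have : τ (τ c) = τ c := Subtype.ext (Prod.ext f1 (hτ' _))
  exact n1 (τ.injective this)

lemma ys_coeff_swap (μ : YoungDiagram) (c d : μ.cells) (hcd : d ≠ c) :
    (youngSymmetrizer μ).coeff (Equiv.swap c d) =
      (if (d : ℕ × ℕ).1 = (c : ℕ × ℕ).1 then 1 else 0)
        - (if (d : ℕ × ℕ).2 = (c : ℕ × ℕ).2 then 1 else 0) := by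
  by_cases h1 : (d : ℕ × ℕ).1 = (c : ℕ × ℕ).1
  · have h2 : (d : ℕ × ℕ).2 ≠ (c : ℕ × ℕ).2 := fun h => hcd (Subtype.ext (Prod.ext h1 h))
    rw [ys_coeff_row, if_pos h1, if_neg h2, sub_zero]
    intro x
    rw [Equiv.swap_apply_def]
    split_ifs with ha hb
    · rw [ha, h1]
    · rw [hb, h1]
    · rfl
  · by_cases h2 : (d : ℕ × ℕ).2 = (c : ℕ × ℕ).2
    · rw [ys_coeff_col, if_neg h1, if_pos h2, Equiv.Perm.sign_swap hcd.symm]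
      · simp
      intro x
      rw [Equiv.swap_apply_def]
      split_ifs with ha hb
      · rw [ha, h2]
      · rw [hb, h2]
      · rfl
    · rw [ys_coeff_swap_zero μ c d (Ne.symm h1) (Ne.symm h2), if_neg h1, if_neg h2, sub_zero]

lemma rigid_len (m : ℕ) (μ : YoungDiagram)
    (hz : ∀ (c₀ : μ.cells) (v : MonoidAlgebra ℂ (Equiv.Perm μ.cells)), v ∈ spechtIdeal μ →
      (∑ c ∈ Finset.univ.erase c₀,
          (MonoidAlgebra.single (Equiv.swap c₀ c) (1 : ℂ) +
            MonoidAlgebra.single (Equiv.swap c₀ c) (1 : ℂ))) * v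
        = (-(2 * m : ℂ)) • v) (i j : ℕ) (hij : (i, j) ∈ μ) :
    μ.colLen j = μ.rowLen i + m := by
  have hmem : (i, j) ∈ μ.cells := hij
  set c₀ : μ.cells := ⟨(i, j), hmem⟩ with hc
  have h := hz c₀ (youngSymmetrizer μ) ⟨1, by simp⟩
  have h' := congrArg (fun v => MonoidAlgebra.coeff v 1) h
  have hone : (youngSymmetrizer μ).coeff 1 = 1 := ys_coeff_row μ 1 (by simp)
  have hs : ∀ c : μ.cells, (MonoidAlgebra.single (Equiv.swap c₀ c) (1 : ℂ) *
      youngSymmetrizer μ).coeff 1 = (youngSymmetrizer μ).coeff (Equiv.swap c₀ c) := by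
    intro c
    rw [MonoidAlgebra.coeff_single_mul_apply]
    simp
  simp only [Finset.sum_mul, add_mul, MonoidAlgebra.coeff_sum, Finsupp.finsetSum_apply,
    MonoidAlgebra.coeff_add, Finsupp.add_apply, hs, MonoidAlgebra.coeff_smul,
    Finsupp.smul_apply, hone, smul_eq_mul, mul_one] at h'
  rw [Finset.sum_congr rfl (fun c hc' => by
    rw [ys_coeff_swap μ c₀ c (Finset.ne_of_mem_erase hc')])] at h'
  rw [Finset.sum_add_distrib, ← two_mul] at h'
  have hsum : (∑ c : μ.cells, ((if (c : ℕ × ℕ).1 = (c₀ : ℕ × ℕ).1 then (1 : ℂ) else 0)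
        - (if (c : ℕ × ℕ).2 = (c₀ : ℕ × ℕ).2 then 1 else 0))) = -m := by
    rw [← Finset.add_sum_erase _ _ (Finset.mem_univ c₀)]
    simp only [if_true, sub_self, zero_add]
    linear_combination h' / 2
  rw [Finset.sum_sub_distrib] at hsum
  have hr : (∑ c : μ.cells, (if (c : ℕ × ℕ).1 = (c₀ : ℕ × ℕ).1 then (1 : ℂ) else 0))
      = μ.rowLen i := by
    rw [Finset.sum_coe_sort μ.cells (fun c => if c.1 = i then (1 : ℂ) else 0),
      Finset.sum_boole, YoungDiagram.rowLen_eq_card]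
    rfl
  have hcl : (∑ c : μ.cells, (if (c : ℕ × ℕ).2 = (c₀ : ℕ × ℕ).2 then (1 : ℂ) else 0))
      = μ.colLen j := by
    rw [Finset.sum_coe_sort μ.cells (fun c => if c.2 = j then (1 : ℂ) else 0),
      Finset.sum_boole, YoungDiagram.colLen_eq_card]
    rfl
  rw [hr, hcl] at hsum
  have : (μ.colLen j : ℂ) = ((μ.rowLen i + m : ℕ) : ℂ) := by
    push_cast
    linear_combination -hsum
  exact_mod_cast this

/-- Rigidity in type `B_n`: if for every coordinate `i` the element
`Σ_{j≠i} ((i,j) + (i,j)ε_i(-1)ε_j(-1))` of the group algebra of `B_n` acts by the scalar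
`-2m` on the `B_n`-representation `π_λ` pulled back from `S_n` (on which the sign changes
`ε_i(-1)` act trivially, so each summand acts as the transposition `(i,j)`), then `λ` is the
rectangle `(k^{k+m})` for some `k > 0` with `n = k(k+m)`.  Here `π_λ` is realized as the
Specht module of shape `λ = μ`. -/
theorem typeB_rigid_implies_box_partition
    (m : ℕ) (μ : YoungDiagram) (hpos : 0 < μ.card)
    (hz : ∀ (c₀ : μ.cells) (v : MonoidAlgebra ℂ (Equiv.Perm μ.cells)), v ∈ spechtIdeal μ →
      (∑ c ∈ Finset.univ.erase c₀,
          (MonoidAlgebra.single (Equiv.swap c₀ c) (1 : ℂ) +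
            MonoidAlgebra.single (Equiv.swap c₀ c) (1 : ℂ))) * v
        = (-(2 * m : ℂ)) • v) :
    ∃ k : ℕ, 0 < k ∧ μ.card = k * (k + m) ∧
      ∀ p : ℕ × ℕ, p ∈ μ ↔ p.1 < k + m ∧ p.2 < k := by
  have hl := rigid_len m μ hz
  obtain ⟨⟨i, j⟩, hij⟩ := Finset.card_pos.mp hpos
  have h00 : (0, 0) ∈ μ := μ.up_left_mem (Nat.zero_le i) (Nat.zero_le j) hij
  have hp : ∀ p : ℕ × ℕ, p ∈ μ ↔ p.1 < μ.rowLen 0 + m ∧ p.2 < μ.rowLen 0 := by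
    rintro ⟨a, b⟩
    constructor
    · intro h
      have h0 : (0, b) ∈ μ := μ.up_left_mem (Nat.zero_le a) le_rfl h
      refine ⟨?_, YoungDiagram.mem_iff_lt_rowLen.mp h0⟩
      rw [← hl 0 b h0]
      exact YoungDiagram.mem_iff_lt_colLen.mp h
    · rintro ⟨ha, hb⟩
      have h0 : (0, b) ∈ μ := YoungDiagram.mem_iff_lt_rowLen.mpr hb
      rw [← hl 0 b h0] at ha
      exact YoungDiagram.mem_iff_lt_colLen.mpr ha
  refine ⟨μ.rowLen 0, YoungDiagram.mem_iff_lt_rowLen.mp h00, ?_, hp⟩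
  have : μ.cells = Finset.range (μ.rowLen 0 + m) ×ˢ Finset.range (μ.rowLen 0) := by
    ext p
    rw [YoungDiagram.mem_cells, hp, Finset.mem_product, Finset.mem_range, Finset.mem_range]
  rw [YoungDiagram.card, this, Finset.card_product, Finset.card_range, Finset.card_range, mul_comm]

end
end
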